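/- If μ is a total-order measure with atoms {mα} (countably many, with Σ mα ≤ ‖μ‖) and diffuse mass m_d = ‖μ‖ − Σ mα, then the strict run coefficients satisfy, for all z ∈ ℂ, Σₙ L°ₙ zⁿ = e^{m_d z} · ∏_α (1 + mα z), where L°ₙ = μⁿ({a₁ < ... < aₙ}). -/

import Mathlib

open MeasureTheory

/-- injective tuples with values in `B` -/
def injSet (n : ℕ) (B : Set ℝ) : Set (Fin n → ℝ) := {f | Function.Injective f ∧ ∀ i, f i ∈ B}

noncomputable def injMass (μ : Measure ℝ) (n : ℕ) (B : Set ℝ) : ℝ :=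
  ((Measure.pi fun _ : Fin n => μ) (injSet n B)).toReal

lemma measurableSet_injSet (n : ℕ) {B : Set ℝ} (hB : MeasurableSet B) :
    MeasurableSet (injSet n B) := by
  have : injSet n B = (⋂ i, ⋂ j, {f | f i = f j → i = j}) ∩ ⋂ i, {f | f i ∈ B} := by
    ext f; simp [injSet, Function.Injective]
  rw [this]
  refine MeasurableSet.inter (MeasurableSet.iInter fun i => MeasurableSet.iInter fun j => ?_)
    (MeasurableSet.iInter fun i => measurable_pi_apply i hB)
  by_cases h : i = j
  · simp [h]
  · simp only [h, imp_false]
    exact (measurableSet_eq_fun (measurable_pi_apply i) (measurable_pi_apply j)).compl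

lemma measurableSet_strictMono (n : ℕ) : MeasurableSet {f : Fin n → ℝ | StrictMono f} := by
  have : {f : Fin n → ℝ | StrictMono f} = ⋂ i, ⋂ j, {f | i < j → f i < f j} := by
    ext f; simp [StrictMono]
  rw [this]
  refine (MeasurableSet.iInter fun i => MeasurableSet.iInter fun j => ?_)
  by_cases h : i < j
  · simp only [h, true_imp_iff]
    exact (measurableSet_lt (measurable_pi_apply i) (measurable_pi_apply j))
  · simp [h]

lemma perm_mass (μ : Measure ℝ) [IsFiniteMeasure μ] (n : ℕ) (σ : Equiv.Perm (Fin n)) :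
    (Measure.pi fun _ : Fin n => μ) {f | StrictMono (f ∘ σ)} =
    (Measure.pi fun _ : Fin n => μ) {f | StrictMono f} := by
  have h := measurePreserving_piCongrLeft (fun _ : Fin n => μ) σ.symm
  rw [← h.measure_preimage (measurableSet_strictMono n).nullMeasurableSet]
  congr 1
  ext f
  simp only [Set.mem_ofPred_eq, Set.mem_preimage]
  have : (MeasurableEquiv.piCongrLeft (fun _ => ℝ) σ.symm) f = f ∘ σ := by
    ext i
    obtain ⟨j, rfl⟩ := σ.symm.surjective i
    rw [MeasurableEquiv.coe_piCongrLeft, Equiv.piCongrLeft_apply_apply]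
    simp
  rw [this]

lemma strict_eq (μ : Measure ℝ) [IsFiniteMeasure μ] (n : ℕ) :
    ((Measure.pi fun _ : Fin n => μ) {f : Fin n → ℝ | StrictMono f}).toReal
      = injMass μ n Set.univ / n.factorial := by
  have key : injSet n Set.univ = ⋃ σ : Equiv.Perm (Fin n), {f | StrictMono (f ∘ σ)} := by
    ext f
    simp only [injSet, Set.mem_univ, implies_true, and_true, Set.mem_ofPred_eq, Set.mem_iUnion]
    constructor
    · intro h
      exact ⟨Tuple.sort f, (Tuple.monotone_sort f).strictMono_of_injective
        (h.comp (Tuple.sort f).injective)⟩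
    · rintro ⟨σ, h⟩
      have := h.injective.comp σ.symm.injective
      simpa [Function.comp_assoc] using this
  have hm : ∀ σ : Equiv.Perm (Fin n), MeasurableSet {f : Fin n → ℝ | StrictMono (f ∘ σ)} := by
    intro σ
    exact (measurable_pi_lambda (fun f : Fin n → ℝ => f ∘ σ)
      (fun i => measurable_pi_apply (σ i))) (measurableSet_strictMono n)
  have hd : Pairwise (Function.onFun Disjoint
      fun σ : Equiv.Perm (Fin n) => {f : Fin n → ℝ | StrictMono (f ∘ σ)}) := by
    intro σ τ hne
    refine Set.disjoint_left.2 fun f hf hg => hne ?_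
    simp only [Set.mem_ofPred_eq] at hf hg
    have h1 := Tuple.unique_monotone hf.monotone hg.monotone
    have hinj : Function.Injective f := by
      simpa [Function.comp_assoc] using hf.injective.comp σ.symm.injective
    ext i
    exact congrArg _ (hinj (congrFun h1 i))
  have : (Measure.pi fun _ : Fin n => μ) (injSet n Set.univ)
      = n.factorial * (Measure.pi fun _ : Fin n => μ) {f | StrictMono f} := by
    rw [key, measure_iUnion hd hm, tsum_fintype]
    simp [perm_mass, Fintype.card_perm]
  rw [injMass, this, ENNReal.toReal_mul]
  have : (n.factorial : ℝ) ≠ 0 := by positivity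
  simp; field_simp

lemma injMass_insert (μ : Measure ℝ) [IsFiniteMeasure μ] (n : ℕ) {B : Set ℝ}
    (hB : MeasurableSet B) {a : ℝ} (ha : a ∉ B) :
    injMass μ (n+1) (insert a B)
      = injMass μ (n+1) B + (n+1) * (μ {a}).toReal * injMass μ n B := by
  set T : Fin (n+1) → Set (Fin (n+1) → ℝ) := fun i =>
    MeasurableEquiv.piFinSuccAbove (fun _ => ℝ) i ⁻¹' ({a} ×ˢ injSet n B) with hT
  have memT : ∀ i f, f ∈ T i ↔ f i = a ∧ (fun j => f (i.succAbove j)) ∈ injSet n B := by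
    intro i f; rfl
  have hTm : ∀ i, MeasurableSet (T i) := fun i =>
    (MeasurableEquiv.measurable _) ((measurableSet_singleton a).prod (measurableSet_injSet n hB))
  have hTv : ∀ i, (Measure.pi fun _ : Fin (n+1) => μ) (T i)
      = μ {a} * (Measure.pi fun _ : Fin n => μ) (injSet n B) := by
    intro i
    rw [hT, (measurePreserving_piFinSuccAbove (fun _ => μ) i).measure_preimage
      ((measurableSet_singleton a).prod (measurableSet_injSet n hB)).nullMeasurableSet,
      Measure.prod_prod]
  have hd : Pairwise (Function.onFun Disjoint T) := by
    intro i j hij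
    refine Set.disjoint_left.2 fun f hf hg => ?_
    rw [memT] at hf hg
    obtain ⟨k, hk⟩ := Fin.exists_succAbove_eq hij.symm
    have := hf.2.2 k
    simp only [hk, hg.1] at this
    exact ha this
  have hun : injSet (n+1) (insert a B) = injSet (n+1) B ∪ ⋃ i, T i := by
    ext f
    simp only [Set.mem_union, Set.mem_iUnion, memT]
    constructor
    · rintro ⟨h1, h2⟩
      by_cases h : ∃ i, f i = a
      · obtain ⟨i, hi⟩ := h
        refine Or.inr ⟨i, hi, fun x y hxy => Fin.succAbove_right_injective (h1 hxy), fun j => ?_⟩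
        refine (h2 _).resolve_left fun h => ?_
        exact Fin.succAbove_ne i j (h1 (h.trans hi.symm))
      · push Not at h
        exact Or.inl ⟨h1, fun i => (h2 i).resolve_left (h i)⟩
    · rintro (⟨h1, h2⟩ | ⟨i, hi, h1, h2⟩)
      · exact ⟨h1, fun i => Or.inr (h2 i)⟩
      · refine ⟨?_, ?_⟩
        · intro x y hxy
          rcases Fin.eq_self_or_eq_succAbove i x with hx | ⟨x', hx⟩ <;>
          rcases Fin.eq_self_or_eq_succAbove i y with hy | ⟨y', hy⟩
          · exact hx.trans hy.symm
          · subst hx hy; exact (ha (by rw [← hi, hxy]; exact h2 y')).elim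
          · subst hx hy; exact (ha (by rw [← hi, ← hxy]; exact h2 x')).elim
          · subst hx hy; exact congrArg _ (h1 hxy)
        · intro x
          rcases Fin.eq_self_or_eq_succAbove i x with rfl | ⟨x', rfl⟩
          · exact Or.inl hi
          · exact Or.inr (h2 x')
  have hd2 : Disjoint (injSet (n+1) B) (⋃ i, T i) := by
    refine Set.disjoint_left.2 fun f hf hg => ?_
    obtain ⟨i, hi⟩ := Set.mem_iUnion.1 hg
    exact ha (((memT i f).1 hi).1 ▸ hf.2 i)
  rw [injMass, hun, measure_union hd2 (MeasurableSet.iUnion hTm), measure_iUnion hd hTm,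
    tsum_fintype]
  simp only [hTv, Finset.sum_const, Finset.card_univ, Fintype.card_fin, nsmul_eq_mul]
  rw [ENNReal.toReal_add (measure_ne_top _ _) (by finiteness)]
  simp only [ENNReal.toReal_mul, injMass]
  rw [ENNReal.toReal_natCast]
  push_cast; ring

lemma injMass_zero (μ : Measure ℝ) [IsFiniteMeasure μ] (B : Set ℝ) : injMass μ 0 B = 1 := by
  have : injSet 0 B = Set.univ := by
    ext f; simp [injSet, Function.injective_of_subsingleton]
  rw [injMass, this]; simp

lemma injMass_le (μ : Measure ℝ) [IsFiniteMeasure μ] (n : ℕ) (B : Set ℝ) :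
    injMass μ n B ≤ (μ Set.univ).toReal ^ n := by
  have := measure_mono (μ := Measure.pi fun _ : Fin n => μ) (Set.subset_univ (injSet n B))
  have h2 := ENNReal.toReal_mono (measure_ne_top _ _) this
  simpa [injMass, Measure.pi_univ] using h2

lemma injMass_nonneg (μ : Measure ℝ) (n : ℕ) (B : Set ℝ) :
    0 ≤ injMass μ n B := ENNReal.toReal_nonneg

lemma eq_null (μ : Measure ℝ) [IsFiniteMeasure μ] (n : ℕ) {B : Set ℝ} (hB : MeasurableSet B)
    (h : ∀ x ∈ B, μ {x} = 0) (i j : Fin n) (hij : i ≠ j) :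
    (Measure.pi fun _ : Fin n => μ) {f | f i = f j ∧ f i ∈ B} = 0 := by
  obtain ⟨n, rfl⟩ : ∃ m, n = m + 1 := ⟨n - 1, by have := i.pos; omega⟩
  obtain ⟨k, rfl⟩ := Fin.exists_succAbove_eq hij.symm
  set S : Set (ℝ × (Fin n → ℝ)) := {p | p.1 = p.2 k ∧ p.1 ∈ B} with hS
  have hSm : MeasurableSet S := by
    have e1 : MeasurableSet {p : ℝ × (Fin n → ℝ) | p.1 = p.2 k} :=
      measurableSet_eq_fun measurable_fst ((measurable_pi_apply k).comp measurable_snd)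
    have e2 : MeasurableSet {p : ℝ × (Fin n → ℝ) | p.1 ∈ B} := measurable_fst hB
    exact e1.inter e2
  have e : {f : Fin (n+1) → ℝ | f i = f (i.succAbove k) ∧ f i ∈ B}
      = MeasurableEquiv.piFinSuccAbove (fun _ => ℝ) i ⁻¹' S := rfl
  rw [e, (measurePreserving_piFinSuccAbove (fun _ => μ) i).measure_preimage
      hSm.nullMeasurableSet, Measure.prod_apply_symm hSm]
  rw [lintegral_eq_zero_iff (measurable_measure_prodMk_right hSm)]
  refine Filter.Eventually.of_forall fun g => ?_
  by_cases hg : g k ∈ B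
  · refine measure_mono_null ?_ (h _ hg)
    rintro x ⟨hx, -⟩
    exact hx
  · refine (congrArg μ ?_).trans (measure_empty (μ := μ))
    ext x
    simp only [hS, Set.mem_preimage, Set.mem_ofPred_eq, Set.mem_empty_iff_false, iff_false]
    rintro ⟨rfl, h⟩
    exact hg h

lemma injMass_diffuse (μ : Measure ℝ) [IsFiniteMeasure μ] (n : ℕ) {B : Set ℝ}
    (hB : MeasurableSet B) (h : ∀ x ∈ B, μ {x} = 0) :
    injMass μ n B = (μ B).toReal ^ n := by
  have h1 : (Measure.pi fun _ : Fin n => μ) (Set.univ.pi fun _ => B) = μ B ^ n := by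
    rw [Measure.pi_pi]; simp
  rw [← ENNReal.toReal_pow, ← h1, injMass]
  congr 1
  refine le_antisymm (measure_mono fun f hf i _ => hf.2 i) ?_
  have : (Set.univ.pi fun _ => B) ⊆ injSet n B ∪
      ⋃ i : Fin n, ⋃ j : Fin n, {f | i ≠ j ∧ f i = f j ∧ f i ∈ B} := by
    intro f hf
    by_cases hi : Function.Injective f
    · exact Or.inl ⟨hi, fun i => hf i trivial⟩
    · right
      simp only [Function.Injective, not_forall] at hi
      obtain ⟨i, j, h1, h2⟩ := hi
      simp only [Set.mem_iUnion]
      exact ⟨i, j, h2, h1, hf i trivial⟩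
  refine (measure_mono this).trans ((measure_union_le _ _).trans ?_)
  rw [measure_iUnion_null, add_zero]
  intro i
  refine measure_iUnion_null fun j => ?_
  by_cases hij : i = j
  · simp [hij]
  · exact measure_mono_null (fun f hf => hf.2) (eq_null μ n hB h i j hij)

noncomputable def genF (μ : Measure ℝ) (z : ℂ) (B : Set ℝ) : ℂ :=
  ∑' n : ℕ, ((injMass μ n B / n.factorial : ℝ) : ℂ) * z ^ n

lemma term_bound (μ : Measure ℝ) [IsFiniteMeasure μ] (z : ℂ) (B : Set ℝ) (n : ℕ) :
    ‖((injMass μ n B / n.factorial : ℝ) : ℂ) * z ^ n‖ ≤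
      ((μ Set.univ).toReal * ‖z‖) ^ n / n.factorial := by
  rw [norm_mul, norm_pow, Complex.norm_real, Real.norm_of_nonneg
    (div_nonneg (injMass_nonneg _ _ _) (by positivity)), mul_pow, div_mul_eq_mul_div]
  gcongr
  exact injMass_le _ _ _

lemma summable_term (μ : Measure ℝ) [IsFiniteMeasure μ] (z : ℂ) (B : Set ℝ) :
    Summable fun n : ℕ => ((injMass μ n B / n.factorial : ℝ) : ℂ) * z ^ n :=
  Summable.of_norm_bounded (Real.summable_pow_div_factorial _) (term_bound μ z B)

lemma genF_insert (μ : Measure ℝ) [IsFiniteMeasure μ] (z : ℂ) {B : Set ℝ}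
    (hB : MeasurableSet B) {a : ℝ} (ha : a ∉ B) :
    genF μ z (insert a B) = (1 + ((μ {a}).toReal : ℂ) * z) * genF μ z B := by
  have s := summable_term μ z B
  rw [genF, (summable_term μ z (insert a B)).tsum_eq_zero_add, add_mul, one_mul]
  have e : ∀ n : ℕ, ((injMass μ (n+1) (insert a B) / (n+1).factorial : ℝ) : ℂ) * z ^ (n+1)
      = ((injMass μ (n+1) B / (n+1).factorial : ℝ) : ℂ) * z ^ (n+1)
        + ((μ {a}).toReal : ℂ) * z * (((injMass μ n B / n.factorial : ℝ) : ℂ) * z ^ n) := by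
    intro n
    rw [injMass_insert μ n hB ha, Nat.factorial_succ]
    have h1 : (n.factorial : ℂ) ≠ 0 := by exact_mod_cast n.factorial_ne_zero
    have h2 : ((n : ℂ) + 1) ≠ 0 := by exact_mod_cast n.succ_ne_zero
    push_cast
    field_simp
    ring
  simp only [e]
  rw [((summable_nat_add_iff 1).2 s).tsum_add (s.mul_left _), tsum_mul_left, ← add_assoc]
  congr 1
  rw [genF, s.tsum_eq_zero_add]
  simp [injMass_zero]

lemma genF_finset (μ : Measure ℝ) [IsFiniteMeasure μ] (z : ℂ) (S : Finset ℝ) :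
    genF μ z Set.univ = (∏ a ∈ S, (1 + ((μ {a}).toReal : ℂ) * z)) * genF μ z ((S : Set ℝ)ᶜ) := by
  classical
  induction S using Finset.induction_on with
  | empty => simp
  | insert a S ha ih =>
    have : ((S : Set ℝ)ᶜ) = insert a (((insert a S : Finset ℝ) : Set ℝ)ᶜ) := by
      ext x
      by_cases hx : x = a
      · simp [hx, ha]
      · simp [hx]
    rw [ih, Finset.prod_insert ha, this, genF_insert μ z (Finset.measurableSet _).compl (by simp)]
    ring

lemma injMass_tendsto (μ : Measure ℝ) [IsFiniteMeasure μ] (n : ℕ) (A : Set ℝ)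
    (hA : A.Countable) :
    Filter.Tendsto (fun S : Finset A => injMass μ n (((fun x : A => (x : ℝ)) '' (S : Set A))ᶜ))
      Filter.atTop (nhds (injMass μ n Aᶜ)) := by
  have := hA.to_subtype
  have e : injSet n Aᶜ = ⋂ S : Finset A, injSet n (((fun x : A => (x : ℝ)) '' (S : Set A))ᶜ) := by
    ext f
    simp only [Set.mem_iInter]
    constructor
    · rintro ⟨h1, h2⟩ S
      refine ⟨h1, fun i => ?_⟩
      rintro ⟨x, -, hx⟩
      exact h2 i (hx ▸ x.2)
    · intro h
      refine ⟨(h ∅).1, fun i hi => ?_⟩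
      exact (h {⟨f i, hi⟩}).2 i ⟨⟨f i, hi⟩, by simp, rfl⟩
  unfold injMass
  refine (ENNReal.tendsto_toReal (measure_ne_top _ _)).comp ?_
  rw [e]
  refine tendsto_measure_iInter_atTop (fun S => ?_) ?_ ⟨∅, measure_ne_top _ _⟩
  · refine (measurableSet_injSet n ?_).nullMeasurableSet
    exact ((S.finite_toSet.image _).measurableSet).compl
  · intro S T hST f hf
    refine ⟨hf.1, fun i hi => hf.2 i ?_⟩
    exact Set.image_mono (Finset.coe_subset.2 hST) hi

theorem stmt11 (μ : Measure ℝ) [IsFiniteMeasure μ] (z : ℂ) :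
    ∑' n : ℕ, (((Measure.pi fun _ : Fin n => μ) {f : Fin n → ℝ | StrictMono f}).toReal : ℂ)
        * z ^ n
      = Complex.exp
          ((((μ Set.univ).toReal
              - ∑' α : {x : ℝ | μ {x} ≠ 0}, (μ {(α : ℝ)}).toReal : ℝ)) * z)
        * ∏' α : {x : ℝ | μ {x} ≠ 0}, (1 + ((μ {(α : ℝ)}).toReal : ℂ) * z) := by
  simp only [strict_eq]
  change genF μ z Set.univ = _
  set A : Set ℝ := {x : ℝ | μ {x} ≠ 0} with hAdef
  have hA : A.Countable := by
    have := Measure.countable_meas_pos_of_disjoint_iUnion (μ := μ) (As := fun x : ℝ => ({x} : Set ℝ))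
      (fun x => measurableSet_singleton x) (fun x y h => by simpa using h)
    simpa [hAdef, pos_iff_ne_zero] using this
  have hμA : ∑' α : A, μ {(α : ℝ)} = μ A := by
    have := measure_biUnion (μ := μ) hA (f := fun x : ℝ => ({x} : Set ℝ))
      (fun x _ y _ h => by simpa using h) (fun x _ => measurableSet_singleton x)
    simpa using this.symm
  have hsum : Summable fun α : A => (μ {(α : ℝ)}).toReal :=
    ENNReal.summable_toReal (by rw [hμA]; exact measure_ne_top _ _)
  have hd : (μ Set.univ).toReal - ∑' α : A, (μ {(α : ℝ)}).toReal = (μ Aᶜ).toReal := by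
    rw [← ENNReal.tsum_toReal_eq (fun _ => measure_ne_top _ _), hμA]
    have := measureReal_compl (μ := μ) hA.measurableSet
    simpa [Measure.real] using this.symm
  have hexp : genF μ z Aᶜ = Complex.exp (((μ Aᶜ).toReal : ℂ) * z) := by
    rw [Complex.exp_eq_exp_ℂ, NormedSpace.exp_eq_tsum_div, genF]
    refine tsum_congr fun n => ?_
    rw [injMass_diffuse μ n hA.measurableSet.compl (fun x hx => by simpa [hAdef] using hx)]
    push_cast
    ring
  have hprod : Multipliable fun α : A => (1 + ((μ {(α : ℝ)}).toReal : ℂ) * z) := by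
    refine multipliable_one_add_of_summable ?_
    simp only [norm_mul, Complex.norm_real]
    exact (hsum.norm).mul_right _
  have hlim : Filter.Tendsto
      (fun S : Finset A => genF μ z (((fun x : A => (x : ℝ)) '' (S : Set A))ᶜ))
      Filter.atTop (nhds (genF μ z Aᶜ)) := by
    refine tendsto_tsum_of_dominated_convergence
      (Real.summable_pow_div_factorial ((μ Set.univ).toReal * ‖z‖)) (fun n => ?_)
      (Filter.Eventually.of_forall fun S n => term_bound μ z _ n)
    refine Filter.Tendsto.mul_const _ ?_
    exact (Complex.continuous_ofReal.tendsto _).comp ((injMass_tendsto μ n A hA).div_const _)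
  have hconst : ∀ S : Finset A, genF μ z Set.univ =
      (∏ α ∈ S, (1 + ((μ {(α : ℝ)}).toReal : ℂ) * z)) *
        genF μ z (((fun x : A => (x : ℝ)) '' (S : Set A))ᶜ) := by
    intro S
    have := genF_finset μ z (S.map (Function.Embedding.subtype _))
    rw [Finset.prod_map, Finset.coe_map] at this
    exact this
  have hp : Filter.Tendsto (fun S : Finset A => ∏ α ∈ S, (1 + ((μ {(α : ℝ)}).toReal : ℂ) * z))
      Filter.atTop (nhds (∏' α : A, (1 + ((μ {(α : ℝ)}).toReal : ℂ) * z))) := by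
    simpa [HasProd] using hprod.hasProd
  have hfin := hp.mul hlim
  rw [hd, ← hexp, mul_comm]
  refine tendsto_nhds_unique ?_ hfin
  exact tendsto_const_nhds.congr hconst
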